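/- Let I ⊆ ℝ be an open interval and a ∈ I. Let k, h : ℝ → ℝ be continuous on I with k nowhere zero on I. Define the separable Volterra operator P(f)(x) := k(x)·∫_a^x h(t)·f(t) dt and the twist 𝔞(x) := k(x)/k(a). Then for all f, g continuous on I and all x ∈ I: P(f)(x)·P(g)(x) = 𝔞(x)·P(t ↦ 𝔞(t)⁻¹·P(f)(t)·g(t))(x) + 𝔞(x)·P(t ↦ 𝔞(t)⁻¹·f(t)·P(g)(t))(x). That is, (C(I), P) is a twisted Rota-Baxter algebra of weight 0 with twist 𝔞 = k(x)/k(a). -/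

import Mathlib

/-- The Volterra operator with separable kernel `K(x,t) = k(x)h(t)` and lower limit `a`:
`P(f)(x) = k(x) · ∫_a^x h(t)f(t) dt`. -/
noncomputable def volterraSep (k h : ℝ → ℝ) (a : ℝ) (f : ℝ → ℝ) (x : ℝ) : ℝ :=
  k x * ∫ t in a..x, h t * f t

/-- On an open order-connected set, the integral of a continuous function is a primitive of it. -/
theorem hasDerivAt_integral_of_continuousOn {I : Set ℝ} (hI : IsOpen I) (hc : I.OrdConnected)
    {a x : ℝ} (ha : a ∈ I) (hx : x ∈ I) {u : ℝ → ℝ} (hu : ContinuousOn u I) :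
    HasDerivAt (fun y => ∫ t in a..y, u t) (u x) x :=
  intervalIntegral.integral_hasDerivAt_right
    (hu.mono (hc.uIcc_subset ha hx)).intervalIntegrable
    (hu.stronglyMeasurableAtFilter hI x hx) (hu.continuousAt (hI.mem_nhds hx))

/-- The product of two primitives vanishing at `a`, by integration by parts. -/
theorem integral_mul_integral_eq_add {I : Set ℝ} (hI : IsOpen I) (hc : I.OrdConnected)
    {a x : ℝ} (ha : a ∈ I) (hx : x ∈ I) {u v : ℝ → ℝ}
    (hu : ContinuousOn u I) (hv : ContinuousOn v I) :
    (∫ t in a..x, u t) * (∫ t in a..x, v t) =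
      (∫ t in a..x, (∫ s in a..t, u s) * v t) + ∫ t in a..x, u t * ∫ s in a..t, v s := by
  have hsub := hc.uIcc_subset ha hx
  have hU : ∀ t ∈ Set.uIcc a x, HasDerivAt (fun y => ∫ s in a..y, u s) (u t) t :=
    fun t ht => hasDerivAt_integral_of_continuousOn hI hc ha (hsub ht) hu
  have hV : ∀ t ∈ Set.uIcc a x, HasDerivAt (fun y => ∫ s in a..y, v s) (v t) t :=
    fun t ht => hasDerivAt_integral_of_continuousOn hI hc ha (hsub ht) hv
  have hparts := intervalIntegral.integral_mul_deriv_eq_deriv_mul hU hV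
    (hu.mono hsub).intervalIntegrable (hv.mono hsub).intervalIntegrable
  simp only [intervalIntegral.integral_same, zero_mul, sub_zero] at hparts
  rw [hparts]
  ring

/-- For an open interval `I ⊆ ℝ`, `a ∈ I`, and a separable kernel
`K(x,t) = k(x)h(t)` with `k` nowhere zero on `I`, the separable Volterra operator `P` is a
twisted Rota-Baxter operator of weight 0 with twist `𝔞(x) = k(x)/k(a)`:
`P(f)(x)P(g)(x) = 𝔞(x)·P(𝔞⁻¹·P(f)·g)(x) + 𝔞(x)·P(𝔞⁻¹·f·P(g))(x)` for `x ∈ I`. -/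
theorem separable_volterra_twisted_rota_baxter
    (I : Set ℝ) (hIopen : IsOpen I) (hIconn : I.OrdConnected)
    (a : ℝ) (ha : a ∈ I)
    (k h : ℝ → ℝ) (hk : ContinuousOn k I) (hh : ContinuousOn h I)
    (hk0 : ∀ x ∈ I, k x ≠ 0) :
    ∀ (f g : ℝ → ℝ), ContinuousOn f I → ContinuousOn g I →
      ∀ x ∈ I,
        volterraSep k h a f x * volterraSep k h a g x =
          (k x / k a) *
              volterraSep k h a
                (fun t => (k t / k a)⁻¹ * volterraSep k h a f t * g t) x +
            (k x / k a) *
              volterraSep k h a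
                (fun t => (k t / k a)⁻¹ * f t * volterraSep k h a g t) x := by
  intro f g hf hg x hx
  have hka := hk0 a ha
  have hk0' : ∀ t ∈ Set.uIcc a x, k t ≠ 0 := fun t ht => hk0 t (hIconn.uIcc_subset ha hx ht)
  have hprod := integral_mul_integral_eq_add hIopen hIconn ha hx (hh.mul hf) (hh.mul hg)
  simp only [Pi.mul_apply] at hprod
  have hleft : (∫ t in a..x, h t * ((k t / k a)⁻¹ * (k t * ∫ s in a..t, h s * f s) * g t)) =
      k a * ∫ t in a..x, (∫ s in a..t, h s * f s) * (h t * g t) := by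
    rw [← intervalIntegral.integral_const_mul]
    refine intervalIntegral.integral_congr fun t ht => ?_
    have := hk0' t ht
    field_simp
  have hright : (∫ t in a..x, h t * ((k t / k a)⁻¹ * f t * (k t * ∫ s in a..t, h s * g s))) =
      k a * ∫ t in a..x, (h t * f t) * ∫ s in a..t, h s * g s := by
    rw [← intervalIntegral.integral_const_mul]
    refine intervalIntegral.integral_congr fun t ht => ?_
    have := hk0' t ht
    field_simp
  simp only [volterraSep]
  rw [hleft, hright, mul_mul_mul_comm, hprod]
  field_simp
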